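/- Let V be a t-dimensional F_q-subspace of F_q^{2n} chosen uniformly at random, b ∈ F_{q²} \ F_q, and K the left kernel of the matrix [[I_n],[b·I_n]] over F_{q²}. Then P((V ⊗ F_{q²}) ∩ K ≠ {0}) ≤ (q^t − 1)(q^t − q)/((q^{2n} − q)(q² − 1)) = O(q^{2t − 2n − 2}). -/

import Mathlib

/-- The number of `t`-dimensional subspaces containing a linearly independent family does not
depend on the family. -/
theorem card_submodule_contains_eq {F U ι : Type*} [Field F] [AddCommGroup U] [Module F U]
    [Finite ι] {s s' : ι → U}
    (hs : LinearIndependent F s) (hs' : LinearIndependent F s') (t : ℕ) :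
    Nat.card {V : Submodule F U // Module.finrank F V = t ∧ ∀ i, s i ∈ V} =
      Nat.card {V : Submodule F U // Module.finrank F V = t ∧ ∀ i, s' i ∈ V} := by
  have : FiniteDimensional F (Submodule.span F (Set.range s)) :=
    FiniteDimensional.span_of_finite F (Set.finite_range s)
  obtain ⟨g, hg⟩ := Submodule.exists_linearEquiv_restrict_eq
    ((Module.Basis.span hs).equiv (Module.Basis.span hs') (Equiv.refl ι))
  have hgs (i : ι) : g (s i) = s' i := by
    have h := hg (Module.Basis.span hs i)
    rw [Module.Basis.equiv_apply] at h
    simpa [Module.Basis.span_apply] using h.symm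
  refine Nat.card_congr ((Submodule.orderIsoMapComap g).toEquiv.subtypeEquiv fun V => ?_)
  have hfin : Module.finrank F (V.map (g : U →ₗ[F] U)) = Module.finrank F V :=
    LinearEquiv.finrank_map_eq g V
  have hmem (i : ι) : s' i ∈ V.map (g : U →ₗ[F] U) ↔ s i ∈ V := by
    rw [← hgs i]
    exact g.injective.mem_set_image
  change _ ↔ Module.finrank F (V.map (g : U →ₗ[F] U)) = t ∧
    ∀ i, s' i ∈ V.map (g : U →ₗ[F] U)
  rw [hfin]
  simp only [hmem]

open Finset in
/-- Double counting of pairs consisting of a `t`-dimensional subspace and a linearly independent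
family of `k` vectors in it. -/
theorem card_submodule_contains_mul {F U : Type*} [Field F] [Fintype F] [AddCommGroup U]
    [Module F U] [Finite U] {k t : ℕ} (hkt : k ≤ t) {s : Fin k → U}
    (hs : LinearIndependent F s) :
    Nat.card {V : Submodule F U // Module.finrank F V = t ∧ ∀ i, s i ∈ V} *
        ∏ i : Fin k, (Fintype.card F ^ Module.finrank F U - Fintype.card F ^ i.val) =
      Nat.card {V : Submodule F U // Module.finrank F V = t} *
        ∏ i : Fin k, (Fintype.card F ^ t - Fintype.card F ^ i.val) := by
  classical
  have : Fintype U := Fintype.ofFinite U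
  have : Fintype (Submodule F U) := Fintype.ofFinite _
  have hkU : k ≤ Module.finrank F U := by
    simpa using hs.fintype_card_le_finrank
  let A : Finset (Submodule F U) := {V | Module.finrank F V = t}
  let B : Finset (Fin k → U) := {v | LinearIndependent F v}
  let r : Submodule F U → (Fin k → U) → Prop := fun V v => ∀ i, v i ∈ V
  have h := sum_card_bipartiteAbove_eq_sum_card_bipartiteBelow (s := A) (t := B) r
  have habove : ∀ V ∈ A, #(B.bipartiteAbove r V) =
      ∏ i : Fin k, (Fintype.card F ^ t - Fintype.card F ^ i.val) := by
    intro V hV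
    have hVt : Module.finrank F V = t := by simpa [A] using hV
    rw [← hVt, ← card_linearIndependent (K := F) (V := V) (by omega),
      ← Fintype.card_coe, ← Nat.card_eq_fintype_card]
    refine Nat.card_congr
      { toFun := fun v => ⟨fun i => ⟨v.1 i, ?_⟩, ?_⟩
        invFun := fun v => ⟨fun i => v.1 i, ?_⟩
        left_inv := fun _ => rfl
        right_inv := fun _ => rfl }
    · have := v.2
      simp only [bipartiteAbove, mem_filter, r] at this
      exact this.2 i
    · have := v.2
      simp only [bipartiteAbove, mem_filter, B, mem_univ, true_and] at this
      exact LinearIndependent.of_comp V.subtype this.1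
    · simp only [bipartiteAbove, mem_filter, B, r, mem_univ, true_and]
      exact ⟨v.2.map' V.subtype V.ker_subtype, fun i => (v.1 i).2⟩
  have hbelow : ∀ v ∈ B, #(A.bipartiteBelow r v) =
      Nat.card {V : Submodule F U // Module.finrank F V = t ∧ ∀ i, s i ∈ V} := by
    intro v hv
    have hv' : LinearIndependent F v := by simpa [B] using hv
    rw [card_submodule_contains_eq hs hv' t, Nat.card_eq_fintype_card, Fintype.card_subtype]
    simp only [bipartiteBelow, A, r, filter_filter]
  have hA : #A = Nat.card {V : Submodule F U // Module.finrank F V = t} := by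
    rw [Nat.card_eq_fintype_card, Fintype.card_subtype]
  have hB : #B = ∏ i : Fin k, (Fintype.card F ^ Module.finrank F U - Fintype.card F ^ i.val) := by
    rw [← card_linearIndependent hkU, Nat.card_eq_fintype_card, Fintype.card_subtype]
  rw [sum_congr rfl habove, sum_congr rfl hbelow, sum_const, sum_const, hA, hB] at h
  rw [smul_eq_mul, smul_eq_mul] at h
  rw [h, mul_comm]

/-- Every `F`-linear functional on `E` maps the `E`-span of `V` back into `V`. -/
theorem comp_mem_of_mem_span_image {F E ι : Type*} [Field F] [Field E] [Algebra F E]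
    (V : Submodule F (ι → F)) {v : ι → E}
    (hv : v ∈ Submodule.span E ((fun v (i : ι) => algebraMap F E (v i)) '' (V : Set (ι → F))))
    (φ : E →ₗ[F] F) : (fun i => φ (v i)) ∈ V := by
  induction hv using Submodule.span_induction generalizing φ with
  | mem x hx =>
    obtain ⟨w, hw, rfl⟩ := hx
    have : (fun i => φ (algebraMap F E (w i))) = φ 1 • w := by
      ext i
      simp [Algebra.algebraMap_eq_smul_one, mul_comm]
    rw [this]
    exact V.smul_mem _ hw
  | zero =>
    simp only [Pi.zero_apply, map_zero]
    exact V.zero_mem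
  | add x y _ _ hx hy =>
    simp only [Pi.add_apply, map_add]
    exact V.add_mem (hx φ) (hy φ)
  | smul c x _ hx => exact hx (φ ∘ₗ LinearMap.mulLeft F c)

/-- The kernel condition for the matrix with blocks `1` and `b • 1`. -/
theorem mem_ker_vecMulLinear_fromRows_one_smul {E : Type*} [Field E] {n : ℕ} {b : E}
    {v : Fin n ⊕ Fin n → E} :
    v ∈ LinearMap.ker
      (Matrix.vecMulLinear (Matrix.fromRows (1 : Matrix (Fin n) (Fin n) E) (b • 1))) ↔
      ∀ i, v (Sum.inl i) = -(b * v (Sum.inr i)) := by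
  rw [LinearMap.mem_ker, Matrix.vecMulLinear_apply, Matrix.vecMul_fromRows, funext_iff]
  simp [Matrix.vecMul_smul, eq_neg_iff_add_eq_zero]

/-- A linear functional of a quadratic extension vanishing on the coordinates of a nonzero kernel
vector is zero. -/
theorem functional_eq_zero_of_comp_eq_zero {F E : Type*} [Field F] [Field E] [Algebra F E]
    (hE : Module.finrank F E = 2) {b : E} (hb : b ∉ Set.range (algebraMap F E)) {n : ℕ}
    {v : Fin n ⊕ Fin n → E} (hv : ∀ i, v (Sum.inl i) = -(b * v (Sum.inr i))) (hv0 : v ≠ 0)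
    (φ : E →ₗ[F] F) (hφ : ∀ i, φ (v i) = 0) : φ = 0 := by
  obtain ⟨i, hi⟩ : ∃ i, v (Sum.inr i) ≠ 0 := by
    by_contra! h
    refine hv0 (funext fun j => ?_)
    rcases j with j | j
    · simp [hv, h]
    · exact h j
  have hli : LinearIndependent F ![v (Sum.inr i), b * v (Sum.inr i)] := by
    rw [LinearIndependent.pair_iff]
    intro x y hxy
    have h : algebraMap F E x + algebraMap F E y * b = 0 := by
      refine (mul_eq_zero.mp (?_ : _ * v (Sum.inr i) = 0)).resolve_right hi
      rw [Algebra.smul_def, Algebra.smul_def] at hxy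
      linear_combination hxy
    have hy : y = 0 := by
      by_contra hy
      have hy' : algebraMap F E y ≠ 0 := by simpa using hy
      refine hb ⟨-x / y, ?_⟩
      rw [map_div₀, map_neg, div_eq_iff hy']
      linear_combination -h
    subst hy
    simpa using h
  have hspan := hli.span_eq_top_of_card_eq_finrank (by simp [hE])
  refine LinearMap.ext_on hspan ?_
  rintro _ ⟨j, rfl⟩
  fin_cases j
  · exact hφ (Sum.inr i)
  · have h := hφ (Sum.inl i)
    rw [hv, map_neg, neg_eq_zero] at h
    exact h

/-- The coordinates of a nonzero kernel vector in an `F`-basis of `E` are independent. -/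
theorem linearIndependent_coord_comp {F E : Type*} [Field F] [Field E] [Algebra F E]
    (hE : Module.finrank F E = 2) {b : E} (hb : b ∉ Set.range (algebraMap F E)) {n : ℕ}
    {v : Fin n ⊕ Fin n → E} (hv : ∀ i, v (Sum.inl i) = -(b * v (Sum.inr i))) (hv0 : v ≠ 0)
    {κ : Type*} [Fintype κ] (B : Module.Basis κ F E) :
    LinearIndependent F fun (j : κ) (i : Fin n ⊕ Fin n) => B.coord j (v i) := by
  classical
  rw [Fintype.linearIndependent_iff]
  intro g hg j
  have h := functional_eq_zero_of_comp_eq_zero hE hb hv hv0 (∑ j, g j • B.coord j) fun i => by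
    simpa using congrFun hg i
  simpa [Finsupp.single_apply] using LinearMap.congr_fun h (B j)

open Finset in
theorem stmt16 (F E : Type*) [Field F] [Field E] [Algebra F E]
    [Fintype F] [Fintype E]
    (hcard : Fintype.card E = Fintype.card F ^ 2)
    (b : E) (hb : b ∉ Set.range (algebraMap F E)) (n t : ℕ)
    (K : Submodule E (Fin n ⊕ Fin n → E))
    (hK : K = LinearMap.ker
      (Matrix.vecMulLinear (Matrix.fromRows (1 : Matrix (Fin n) (Fin n) E) (b • 1)))) :
    (Nat.card {V : Submodule F (Fin n ⊕ Fin n → F) //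
        Module.finrank F V = t ∧
        Submodule.span E
          ((fun v (i : Fin n ⊕ Fin n) => algebraMap F E (v i)) ''
            (V : Set (Fin n ⊕ Fin n → F))) ⊓ K ≠ ⊥}) *
      ((Fintype.card F ^ (2 * n) - Fintype.card F) * (Fintype.card F ^ 2 - 1)) ≤
    (Nat.card {V : Submodule F (Fin n ⊕ Fin n → F) // Module.finrank F V = t}) *
      ((Fintype.card F ^ t - 1) * (Fintype.card F ^ t - Fintype.card F)) := by
  classical
  have : Fintype (Submodule F (Fin n ⊕ Fin n → F)) := Fintype.ofFinite _
  have hq : 1 < Fintype.card F := Fintype.one_lt_card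
  have hE : Module.finrank F E = 2 := by
    have h := Module.card_eq_pow_finrank (K := F) (V := E)
    rw [hcard] at h
    exact (Nat.pow_right_injective hq h).symm
  have hmemK {v : Fin n ⊕ Fin n → E} : v ∈ K ↔ ∀ i, v (Sum.inl i) = -(b * v (Sum.inr i)) := by
    rw [hK, mem_ker_vecMulLinear_fromRows_one_smul]
  let B := Module.finBasisOfFinrankEq F E hE
  let c : (Fin n ⊕ Fin n → E) → Fin 2 → Fin n ⊕ Fin n → F := fun v j i => B.coord j (v i)
  let X : Finset (Submodule F (Fin n ⊕ Fin n → F)) := {V | Module.finrank F V = t ∧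
    Submodule.span E ((fun v (i : Fin n ⊕ Fin n) => algebraMap F E (v i)) ''
      (V : Set (Fin n ⊕ Fin n → F))) ⊓ K ≠ ⊥}
  let Y : Finset (Fin n ⊕ Fin n → E) := {v | v ∈ K ∧ v ≠ 0}
  let r : Submodule F (Fin n ⊕ Fin n → F) → (Fin n ⊕ Fin n → E) → Prop :=
    fun V v => ∀ j, c v j ∈ V
  have hX : Nat.card {V : Submodule F (Fin n ⊕ Fin n → F) // Module.finrank F V = t ∧
      Submodule.span E ((fun v (i : Fin n ⊕ Fin n) => algebraMap F E (v i)) ''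
        (V : Set (Fin n ⊕ Fin n → F))) ⊓ K ≠ ⊥} = #X := by
    rw [Nat.card_eq_fintype_card, Fintype.card_subtype]
  rw [hX]
  have hli {v : Fin n ⊕ Fin n → E} (hv : v ∈ Y) : LinearIndependent F (c v) := by
    simp only [Y, mem_filter, mem_univ, true_and] at hv
    exact linearIndependent_coord_comp hE hb (hmemK.1 hv.1) hv.2 B
  have hY : #Y ≤ Fintype.card F ^ (2 * n) - 1 := by
    have hmap : #Y ≤ #((univ : Finset (Fin n → E)).erase 0) := by
      refine card_le_card_of_injOn (fun v i => v (Sum.inr i)) ?_ ?_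
      · intro v hv
        simp only [Y, coe_filter, mem_univ, true_and, Set.mem_ofPred_eq] at hv
        simp only [coe_erase, coe_univ, Set.mem_sdiff, Set.mem_univ, Set.mem_singleton_iff, true_and]
        intro h0
        refine hv.2 (funext fun j => ?_)
        rcases j with j | j
        · simpa [hmemK.1 hv.1 j] using Or.inr (congrFun h0 j)
        · exact congrFun h0 j
      · intro v hv w hw hvw
        simp only [Y, coe_filter, mem_univ, true_and, Set.mem_ofPred_eq] at hv hw
        funext j
        rcases j with j | j
        · rw [hmemK.1 hv.1 j, hmemK.1 hw.1 j, show v (Sum.inr j) = w (Sum.inr j) from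
            congrFun hvw j]
        · exact congrFun hvw j
    rwa [card_erase_of_mem (mem_univ _), card_univ, Fintype.card_fun, Fintype.card_fin, hcard,
      ← pow_mul] at hmap
  have habove : ∀ V ∈ X, Fintype.card F ^ 2 - 1 ≤ #(Y.bipartiteAbove r V) := by
    intro V hV
    simp only [X, mem_filter, mem_univ, true_and] at hV
    obtain ⟨v, hv, hv0⟩ := Submodule.exists_mem_ne_zero_of_ne_bot hV.2
    have hE' : #((univ : Finset E).erase 0) = Fintype.card F ^ 2 - 1 := by
      rw [card_erase_of_mem (mem_univ _), card_univ, hcard]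
    rw [← hE']
    refine card_le_card_of_injOn (fun a => a • v) ?_ ((smul_left_injective E hv0).injOn)
    intro a ha
    have ha0 : a ≠ 0 := by simpa using ha
    have hav := Submodule.smul_mem _ a hv
    simp only [bipartiteAbove, coe_filter, Set.mem_ofPred_eq, Y, mem_filter, mem_univ, true_and]
    exact ⟨⟨hav.2, smul_ne_zero ha0 hv0⟩,
      fun j => comp_mem_of_mem_span_image V hav.1 (B.coord j)⟩
  obtain hY0 | ⟨w, hw⟩ := Y.eq_empty_or_nonempty
  · have hX0 : X = ∅ := by
      refine eq_empty_of_forall_notMem fun V hV => ?_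
      have h := habove V hV
      have : 1 < Fintype.card F ^ 2 := Nat.one_lt_pow two_ne_zero hq
      simp only [hY0, bipartiteAbove, filter_empty, card_empty] at h
      omega
    simp [hX0]
  set M := Nat.card {V : Submodule F (Fin n ⊕ Fin n → F) //
    Module.finrank F V = t ∧ ∀ j, c w j ∈ V} with hM
  have hbelow : ∀ v ∈ Y, #(X.bipartiteBelow r v) ≤ M := by
    intro v hv
    rw [hM, card_submodule_contains_eq (hli hw) (hli hv) t, Nat.card_eq_fintype_card,
      Fintype.card_subtype]
    refine card_le_card fun V hV => ?_
    simp only [X, bipartiteBelow, mem_filter, mem_univ, true_and] at hV ⊢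
    exact ⟨hV.1.1, hV.2⟩
  have hcount : #X * (Fintype.card F ^ 2 - 1) ≤ #Y * M := by
    simpa using card_nsmul_le_card_nsmul r habove hbelow
  have hMt : M * ((Fintype.card F ^ (2 * n) - 1) * (Fintype.card F ^ (2 * n) - Fintype.card F)) ≤
      Nat.card {V : Submodule F (Fin n ⊕ Fin n → F) // Module.finrank F V = t} *
        ((Fintype.card F ^ t - 1) * (Fintype.card F ^ t - Fintype.card F)) := by
    by_cases ht : 2 ≤ t
    · have h := card_submodule_contains_mul ht (hli hw)
      rw [Module.finrank_fintype_fun_eq_card, Fintype.card_sum, Fintype.card_fin, ← two_mul] at h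
      simp only [Fin.prod_univ_two, Fin.val_zero, Fin.val_one, pow_zero, pow_one] at h
      exact h.le
    · have hM0 : M = 0 := by
        rw [hM, Nat.card_eq_zero]
        left
        refine ⟨fun V => ht ?_⟩
        have hV : LinearIndependent F fun j => (⟨c w j, V.2.2 j⟩ : V.1) :=
          LinearIndependent.of_comp V.1.subtype (hli hw)
        have h := hV.fintype_card_le_finrank
        rwa [V.2.1, Fintype.card_fin] at h
      simp [hM0]
  calc #X * ((Fintype.card F ^ (2 * n) - Fintype.card F) * (Fintype.card F ^ 2 - 1))
      = #X * (Fintype.card F ^ 2 - 1) * (Fintype.card F ^ (2 * n) - Fintype.card F) := by ring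
    _ ≤ (Fintype.card F ^ (2 * n) - 1) * M *
        (Fintype.card F ^ (2 * n) - Fintype.card F) :=
      Nat.mul_le_mul_right _ (hcount.trans (Nat.mul_le_mul_right M hY))
    _ = M * ((Fintype.card F ^ (2 * n) - 1) *
        (Fintype.card F ^ (2 * n) - Fintype.card F)) := by ring
    _ ≤ _ := hMt
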